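/- Let N ∈ ℕ, let p_1,…,p_{d+1} be distinct primes, for each j let m_j ∈ ℕ be minimal such that N < p_j^{m_j}, and let γ = (γ_j)_{j≥1} be a non-increasing sequence of weights with 1 ≥ γ_1 ≥ γ_2 ≥ … > 0. Fix σ_1 ∈ ℚ(p_1^{m_1}),…,σ_d ∈ ℚ(p_d^{m_d}), and suppose σ_{d+1} ∈ ℚ(p_{d+1}^{m_{d+1}}) minimizes σ ↦ e²_{N,d+1}(H_{(p_1,…,p_{d+1}),N} ⊕^{simi} (σ_1,…,σ_d,σ)) over ℚ(p_{d+1}^{m_{d+1}}). Then e²_{N,d+1}(H_{(p_1,…,p_{d+1}),N} ⊕^{simi} (σ_1,…,σ_d,σ_{d+1})) ≤ ∫_0^1 e²_{N,d+1}((H_{(p_1,…,p_d),N} ⊕^{simi} (σ_1,…,σ_d), H_{p_{d+1},N} ⊕_{p_{d+1}} σ)) dσ, where (X,Y) denotes the point set of concatenated points (x_k, y_k), k = 0,…,N−1. -/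

import Mathlib

open MeasureTheory Finset

/-- The digit of `x ∈ [0,1)` at base-`p` position `r` (the coefficient of `p^{-(r+1)}`),
using the finite expansion for `p`-adic rationals. -/
noncomputable def rdigit (p : ℕ) (x : ℝ) (r : ℕ) : ℕ :=
  (⌊x * (p : ℝ) ^ (r + 1)⌋).toNat % p

/-- The value of the `p`-adic integer `φ_p^+(x)` modulo `p^m`, as a natural number. -/
noncomputable def truncVal (p : ℕ) (x : ℝ) (m : ℕ) : ℕ :=
  ∑ r ∈ Finset.range m, rdigit p x r * p ^ r

/-- Digit `r` of the `p`-adic sum `φ_p^+(x) +_{ℤ_p} φ_p^+(σ)`. -/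
noncomputable def sdigit (p : ℕ) (x σ : ℝ) (r : ℕ) : ℕ :=
  (truncVal p x (r + 1) + truncVal p σ (r + 1)) % p ^ (r + 1) / p ^ r

/-- The `p`-adic shift `x ⊕_p σ = φ_p(φ_p^+(x) +_{ℤ_p} φ_p^+(σ))` (the Monna map applied to
the `p`-adic sum, taken mod 1). -/
noncomputable def pshift (p : ℕ) (x σ : ℝ) : ℝ :=
  Int.fract (∑' r : ℕ, (sdigit p x σ r : ℝ) / (p : ℝ) ^ (r + 1))

/-- The simplified `p`-adic shift `x ⊕_{p,m}^{simp} σ`: the truncation of `x ⊕_p σ` to its `m`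
most significant base-`p` digits. -/
noncomputable def simpShift (p m : ℕ) (x σ : ℝ) : ℝ :=
  ∑ r ∈ Finset.range m, (sdigit p x σ r : ℝ) / (p : ℝ) ^ (r + 1)

/-- The mid-simplified `p`-adic shift `x ⊕_{p,m}^{simi} σ = (x ⊕_{p,m}^{simp} σ) + 1/(2p^m)`. -/
noncomputable def midShift (p m : ℕ) (x σ : ℝ) : ℝ :=
  simpShift p m x σ + 1 / (2 * (p : ℝ) ^ m)

/-- The radical inverse function `φ_p(n) = Σ_r n_r p^{-(r+1)}` in base `p`. -/
noncomputable def radInv (p n : ℕ) : ℝ :=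
  ∑' r : ℕ, ((n / p ^ r % p : ℕ) : ℝ) / (p : ℝ) ^ (r + 1)

/-- Membership in `ℚ(p^m) = {a p^{-m} : a = 0,1,…,p^m - 1}`. -/
def QSet (p m : ℕ) (x : ℝ) : Prop :=
  ∃ a : ℕ, a < p ^ m ∧ x = (a : ℝ) / (p : ℝ) ^ m

/-- The squared worst-case error of the QMC rule based on the `N`-element point set
`P ⊆ [0,1)^d` in the weighted anchored Sobolev space with weights `γ` (0-indexed, so the
paper's `γ_j` is `γ (j-1)`). -/
noncomputable def sqErr (d N : ℕ) (γ : ℕ → ℝ) (P : Fin N → Fin d → ℝ) : ℝ :=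
  (∏ j : Fin d, (1 + γ j.val / 3))
    - 2 / (N : ℝ) * ∑ n : Fin N, ∏ j : Fin d, (1 + γ j.val / 2 * (1 - P n j ^ 2))
    + 1 / (N : ℝ) ^ 2 *
        ∑ n : Fin N, ∑ h : Fin N, ∏ j : Fin d, (1 + γ j.val * min (1 - P n j) (1 - P h j))

theorem sdigit_comm (p : ℕ) (x σ : ℝ) (r : ℕ) : sdigit p x σ r = sdigit p σ x r := by
  simp [sdigit, add_comm]

theorem sdigit_eq_mod {p : ℕ} (hp : 0 < p) (x σ : ℝ) (r : ℕ) :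
    sdigit p x σ r =
      ((truncVal p x r + truncVal p σ r) / p ^ r + rdigit p x r + rdigit p σ r) % p := by
  have hr : 0 < p ^ r := by positivity
  rw [sdigit, pow_succ, Nat.mod_mul_right_div_self]
  congr 1
  rw [truncVal, truncVal, sum_range_succ, sum_range_succ, ← truncVal, ← truncVal,
    show truncVal p x r + rdigit p x r * p ^ r + (truncVal p σ r + rdigit p σ r * p ^ r)
      = truncVal p x r + truncVal p σ r + p ^ r * (rdigit p x r + rdigit p σ r) by ring,
    Nat.add_mul_div_left _ _ hr, add_assoc]

theorem sdigit_lt {p : ℕ} (hp : 0 < p) (x σ : ℝ) (r : ℕ) : sdigit p x σ r < p := by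
  rw [sdigit_eq_mod hp]
  exact Nat.mod_lt _ hp

theorem rdigit_lt {p : ℕ} (hp : 0 < p) (x : ℝ) (r : ℕ) : rdigit p x r < p :=
  Nat.mod_lt _ hp

theorem truncVal_congr {p : ℕ} {x y : ℝ} {m : ℕ} (h : ∀ r < m, rdigit p x r = rdigit p y r) :
    truncVal p x m = truncVal p y m :=
  sum_congr rfl fun r hr => by rw [h r (mem_range.1 hr)]

theorem sdigit_congr {p : ℕ} {x y : ℝ} (σ : ℝ) {r : ℕ}
    (h : ∀ s ≤ r, rdigit p x s = rdigit p y s) : sdigit p σ x r = sdigit p σ y r := by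
  rw [sdigit, sdigit, truncVal_congr fun s hs => h s (by lia)]

/-- The first `m` digits of a `p`-adic shift determine the first `m` digits of the shift
parameter. -/
theorem rdigit_eq_of_sdigit_eq {p : ℕ} (hp : 0 < p) (x : ℝ) {σ τ : ℝ} (m : ℕ)
    (h : ∀ r < m, sdigit p x σ r = sdigit p x τ r) : ∀ r < m, rdigit p σ r = rdigit p τ r := by
  intro r
  induction r using Nat.strong_induction_on with
  | _ r ih =>
    intro hr
    have h1 := h r hr
    rw [sdigit_eq_mod hp, sdigit_eq_mod hp,
      truncVal_congr fun s hs => ih s hs (hs.trans hr)] at h1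
    have h2 : rdigit p σ r ≡ rdigit p τ r [MOD p] := Nat.ModEq.add_left_cancel' _ h1
    exact Nat.ModEq.eq_of_lt_of_lt h2 (rdigit_lt hp _ _) (rdigit_lt hp _ _)

/-- The digits of a number in an elementary interval of length `p ^ (-k)`. -/
theorem rdigit_of_mem {p : ℕ} (hp : 0 < p) {k a : ℕ} {x : ℝ}
    (hx : x ∈ Set.Ico ((a : ℝ) / (p : ℝ) ^ k) (((a : ℝ) + 1) / (p : ℝ) ^ k)) {r : ℕ}
    (hr : r < k) : rdigit p x r = a / p ^ (k - (r + 1)) % p := by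
  have hp' : (0 : ℝ) < p := by exact_mod_cast hp
  have hk : (0 : ℝ) < (p : ℝ) ^ k := by positivity
  rw [rdigit, Int.floor_toNat]
  congr 1
  have h1 : x * (p : ℝ) ^ (r + 1) = x * (p : ℝ) ^ k / ((p ^ (k - (r + 1)) : ℕ) : ℝ) := by
    rw [eq_div_iff (by positivity)]
    push_cast
    rw [mul_assoc, ← pow_add]
    congr 2
    lia
  have h2 : ⌊x * (p : ℝ) ^ k⌋₊ = a := by
    rw [Nat.floor_eq_iff (mul_nonneg (le_trans (by positivity) hx.1) hk.le)]
    exact ⟨(div_le_iff₀ hk).1 hx.1, (lt_div_iff₀ hk).1 hx.2⟩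
  rw [Set.mem_Ico] at hx
  rw [h1, Nat.floor_div_natCast, h2]

theorem left_mem_Ico_div {p : ℕ} (hp : 0 < p) (k a : ℕ) :
    (a : ℝ) / (p : ℝ) ^ k ∈ Set.Ico ((a : ℝ) / (p : ℝ) ^ k) (((a : ℝ) + 1) / (p : ℝ) ^ k) := by
  have hp' : (0 : ℝ) < p := by exact_mod_cast hp
  refine ⟨le_rfl, ?_⟩
  gcongr
  linarith

theorem simpShift_of_mem {p : ℕ} (hp : 0 < p) {k a : ℕ} {τ : ℝ}
    (hτ : τ ∈ Set.Ico ((a : ℝ) / (p : ℝ) ^ k) (((a : ℝ) + 1) / (p : ℝ) ^ k)) (x : ℝ) :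
    simpShift p k x τ = simpShift p k x ((a : ℝ) / (p : ℝ) ^ k) := by
  refine sum_congr rfl fun r hr => ?_
  rw [mem_range] at hr
  rw [sdigit_congr x fun s hs => ?_]
  rw [rdigit_of_mem hp hτ (by lia), rdigit_of_mem hp (left_mem_Ico_div hp k a) (by lia)]

theorem measurable_sdigit (p : ℕ) (x : ℝ) (r : ℕ) : Measurable fun τ => sdigit p x τ r := by
  have h1 : ∀ s, Measurable fun τ : ℝ => rdigit p τ s := fun s => by
    have : Measurable fun τ : ℝ => ⌊τ * (p : ℝ) ^ (s + 1)⌋ := by fun_prop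
    exact (measurable_from_top (f := fun z : ℤ => z.toNat % p)).comp this
  have h2 : Measurable fun τ : ℝ => truncVal p τ (r + 1) :=
    Finset.measurable_sum _ fun s _ => (h1 s).mul_const _
  exact (measurable_from_top
    (f := fun t : ℕ => (truncVal p x (r + 1) + t) % p ^ (r + 1) / p ^ r)).comp h2

/-- The digits of the `p`-adic sum, as elements of `Fin p`. -/
noncomputable def sdigitFin {p : ℕ} (hp : 0 < p) (x σ : ℝ) (r : ℕ) : Fin p :=
  ⟨sdigit p x σ r, sdigit_lt hp x σ r⟩

/-- The `p`-adic shift before reduction modulo one. -/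
noncomputable def rawShift (p : ℕ) (x σ : ℝ) : ℝ :=
  ∑' r : ℕ, (sdigit p x σ r : ℝ) / (p : ℝ) ^ (r + 1)

theorem rawShift_eq_ofDigits {p : ℕ} (hp : 0 < p) (x σ : ℝ) :
    rawShift p x σ = Real.ofDigits (sdigitFin hp x σ) := rfl

theorem simpShift_eq_sum {p : ℕ} (hp : 0 < p) (m : ℕ) (x σ : ℝ) :
    simpShift p m x σ = ∑ r ∈ range m, Real.ofDigitsTerm (sdigitFin hp x σ) r := rfl

theorem hasSum_rawShift {p : ℕ} (hp : 0 < p) (x σ : ℝ) :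
    HasSum (fun r : ℕ => (sdigit p x σ r : ℝ) / (p : ℝ) ^ (r + 1)) (rawShift p x σ) :=
  (Real.summable_ofDigitsTerm (digits := sdigitFin hp x σ)).hasSum

theorem rawShift_nonneg {p : ℕ} (hp : 0 < p) (x σ : ℝ) : 0 ≤ rawShift p x σ := by
  rw [rawShift_eq_ofDigits hp]; exact Real.ofDigits_nonneg _

theorem rawShift_le_one {p : ℕ} (hp : 0 < p) (x σ : ℝ) : rawShift p x σ ≤ 1 := by
  rw [rawShift_eq_ofDigits hp]; exact Real.ofDigits_le_one _

theorem simpShift_le_rawShift {p : ℕ} (hp : 0 < p) (m : ℕ) (x σ : ℝ) :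
    simpShift p m x σ ≤ rawShift p x σ := by
  rw [rawShift_eq_ofDigits hp, simpShift_eq_sum hp, Real.ofDigits_eq_sum_add_ofDigits _ m]
  have := Real.ofDigits_nonneg fun i => sdigitFin hp x σ (i + m)
  have : 0 ≤ ((p : ℝ) ^ m)⁻¹ * Real.ofDigits fun i => sdigitFin hp x σ (i + m) := by positivity
  linarith

theorem rawShift_le_simpShift_add {p : ℕ} (hp : 0 < p) (m : ℕ) (x σ : ℝ) :
    rawShift p x σ ≤ simpShift p m x σ + 1 / (p : ℝ) ^ m := by
  rw [rawShift_eq_ofDigits hp, simpShift_eq_sum hp, Real.ofDigits_eq_sum_add_ofDigits _ m]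
  have h1 := Real.ofDigits_le_one fun i => sdigitFin hp x σ (i + m)
  have h2 : ((p : ℝ) ^ m)⁻¹ * (Real.ofDigits fun i => sdigitFin hp x σ (i + m))
      ≤ ((p : ℝ) ^ m)⁻¹ * 1 := by gcongr
  rw [one_div]
  linarith

theorem simpShift_nonneg (p m : ℕ) (x σ : ℝ) : 0 ≤ simpShift p m x σ := by
  unfold simpShift; positivity

/-- A truncated shift is an integer multiple of `p ^ (-m)` strictly below one. -/
theorem exists_simpShift_eq_div {p : ℕ} (hp : 0 < p) (m : ℕ) (x σ : ℝ) :
    ∃ K : ℕ, K < p ^ m ∧ simpShift p m x σ = (K : ℝ) / (p : ℝ) ^ m := by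
  have hp' : (0 : ℝ) < p := by exact_mod_cast hp
  induction m with
  | zero => exact ⟨0, by simp, by simp [simpShift]⟩
  | succ m ih =>
    obtain ⟨K, hK, h⟩ := ih
    refine ⟨p * K + sdigit p x σ m, ?_, ?_⟩
    · have := sdigit_lt hp x σ m
      calc p * K + sdigit p x σ m < p * (K + 1) := by rw [mul_add, mul_one]; lia
        _ ≤ p * p ^ m := Nat.mul_le_mul_left _ hK
        _ = p ^ (m + 1) := by ring
    · rw [simpShift, sum_range_succ, ← simpShift, h]
      push_cast
      rw [pow_succ]
      field_simp

theorem midShift_mem_Icc {p : ℕ} (hp : 0 < p) (m : ℕ) (x σ : ℝ) :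
    midShift p m x σ ∈ Set.Icc (0 : ℝ) 1 := by
  have hp' : (0 : ℝ) < p := by exact_mod_cast hp
  have h0 := simpShift_nonneg p m x σ
  obtain ⟨K, hK, h⟩ := exists_simpShift_eq_div hp m x σ
  refine ⟨by unfold midShift; positivity, ?_⟩
  have hK' : (K : ℝ) + 1 ≤ (p : ℝ) ^ m := by exact_mod_cast hK
  rw [midShift, h, ← sub_nonneg]
  have : 1 - ((K : ℝ) / (p : ℝ) ^ m + 1 / (2 * (p : ℝ) ^ m))
      = ((p : ℝ) ^ m - K - 1 / 2) / (p : ℝ) ^ m := by field_simp; ring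
  rw [this]
  apply div_nonneg <;> [linarith; positivity]

theorem sdigit_eq_of_simpShift_eq {p : ℕ} (hp : 0 < p) {x y σ τ : ℝ} (m : ℕ)
    (h : simpShift p m x σ = simpShift p m y τ) : ∀ r < m, sdigit p x σ r = sdigit p y τ r := by
  have hp' : (0 : ℝ) < p := by exact_mod_cast hp
  induction m with
  | zero => simp
  | succ m ih =>
    obtain ⟨K, -, hK⟩ := exists_simpShift_eq_div hp m x σ
    obtain ⟨L, -, hL⟩ := exists_simpShift_eq_div hp m y τ
    rw [simpShift, simpShift, sum_range_succ, sum_range_succ, ← simpShift, ← simpShift, hK, hL]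
      at h
    have hs := sdigit_lt hp x σ m
    have ht := sdigit_lt hp y τ m
    have h1 : p * K + sdigit p x σ m = p * L + sdigit p y τ m := by
      rw [pow_succ] at h
      field_simp at h
      have h' : (p : ℝ) * K + sdigit p x σ m = p * L + sdigit p y τ m := by linarith
      exact_mod_cast h'
    have h2 : sdigit p x σ m = sdigit p y τ m := by
      have := congrArg (· % p) h1
      simpa [Nat.mul_add_mod, Nat.mod_eq_of_lt, hs, ht] using this
    have h3 : K = L := by
      rw [h2] at h1
      exact Nat.eq_of_mul_eq_mul_left hp (by lia)
    intro r hr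
    rcases Nat.lt_succ_iff_lt_or_eq.1 hr with hr | rfl
    · exact ih (by rw [hK, hL, h3]) r hr
    · exact h2

theorem measurable_rawShift {p : ℕ} (hp : 0 < p) (x : ℝ) :
    Measurable fun τ => rawShift p x τ := by
  refine measurable_of_tendsto_metrizable (f := fun n τ =>
    ∑ r ∈ range n, (sdigit p x τ r : ℝ) / (p : ℝ) ^ (r + 1)) (fun n => ?_) ?_
  · refine Finset.measurable_sum _ fun r _ => Measurable.div_const ?_ _
    exact (measurable_from_top (f := fun n : ℕ => (n : ℝ))).comp (measurable_sdigit p x r)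
  · exact tendsto_pi_nhds.2 fun τ => (hasSum_rawShift hp x τ).tendsto_sum_nat

theorem intervalIntegrable_of_bounded {f : ℝ → ℝ} (hf : Measurable f) (C : ℝ)
    (h : ∀ x, |f x| ≤ C) (a b : ℝ) : IntervalIntegrable f volume a b :=
  (intervalIntegrable_const (c := C)).mono_fun hf.aestronglyMeasurable
    (Filter.Eventually.of_forall fun x => by
      simpa using (h x).trans (le_abs_self C))

/-- An elementary interval splits into `q` elementary intervals of the next finer level. -/
theorem integral_Ico_div_split {f : ℝ → ℝ} (hf : ∀ a b, IntervalIntegrable f volume a b)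
    {q : ℕ} (hq : 0 < q) (M : ℝ) (a : ℕ) :
    ∫ x in ((a : ℝ) / M)..(((a : ℝ) + 1) / M), f x =
      ∑ e ∈ range q, ∫ x in (((a * q + e : ℕ) : ℝ) / (M * q))..
        ((((a * q + e : ℕ) : ℝ) + 1) / (M * q)), f x := by
  have hq' : (q : ℝ) ≠ 0 := by positivity
  have := intervalIntegral.sum_integral_adjacent_intervals (μ := volume) (f := f) (n := q)
    (a := fun e : ℕ => ((a * q + e : ℕ) : ℝ) / (M * q)) fun k _ => hf _ _
  have h0 : ((a * q + 0 : ℕ) : ℝ) / (M * q) = (a : ℝ) / M := by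
    push_cast
    rw [add_zero, mul_div_mul_right _ _ hq']
  have h1 : ((a * q + q : ℕ) : ℝ) / (M * q) = ((a : ℝ) + 1) / M := by
    push_cast
    rw [← mul_div_mul_right ((a : ℝ) + 1) M hq']
    ring
  simp only [h0, h1] at this
  rw [← this]
  refine sum_congr rfl fun e _ => ?_
  push_cast
  simp only [add_assoc]

theorem sum_range_add_mod {p : ℕ} (hp : 0 < p) (c : ℕ) :
    ∑ e ∈ range p, (((c + e) % p : ℕ) : ℝ) = p * ((p : ℝ) - 1) / 2 := by
  have h1 : ∑ e ∈ range p, (c + e) % p = ∑ e ∈ range p, e := by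
    refine sum_nbij (fun e => (c + e) % p) (fun e _ => by simpa using Nat.mod_lt _ hp) ?_ ?_
      (fun _ _ => rfl)
    · intro e he e' he' h
      simp only [coe_range, Set.mem_Iio] at he he'
      exact Nat.ModEq.eq_of_lt_of_lt (Nat.ModEq.add_left_cancel' c h) he he'
    · refine surjOn_of_injOn_of_card_le _ (fun e _ => by simpa using Nat.mod_lt _ hp) ?_ le_rfl
      intro e he e' he' h
      simp only [coe_range, Set.mem_Iio] at he he'
      exact Nat.ModEq.eq_of_lt_of_lt (Nat.ModEq.add_left_cancel' c h) he he'
  rw [← Nat.cast_sum, h1]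
  have h2 := Finset.sum_range_id_mul_two p
  have h3 : ((∑ e ∈ range p, e : ℕ) : ℝ) * 2 = p * ((p : ℝ) - 1) := by
    rw [← Nat.cast_pred hp]
    exact_mod_cast h2
  linarith

theorem intervalIntegrable_sdigit {p : ℕ} (hp : 0 < p) (x : ℝ) (r : ℕ) (a b : ℝ) :
    IntervalIntegrable (fun τ => (sdigit p x τ r : ℝ)) volume a b := by
  refine intervalIntegrable_of_bounded
    ((measurable_from_top (f := fun n : ℕ => (n : ℝ))).comp (measurable_sdigit p x r)) p
    (fun τ => ?_) a b
  rw [Function.comp_apply, Nat.abs_cast]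
  exact_mod_cast (sdigit_lt hp x τ r).le

/-- On a long enough elementary interval every digit of the shift is equidistributed. -/
theorem integral_sdigit {p : ℕ} (hp : 0 < p) (x : ℝ) (j k a : ℕ) :
    ∫ τ in ((a : ℝ) / (p : ℝ) ^ k)..(((a : ℝ) + 1) / (p : ℝ) ^ k), (sdigit p x τ (k + j) : ℝ) =
      ((p : ℝ) - 1) / 2 / (p : ℝ) ^ k := by
  have hp' : (0 : ℝ) < p := by exact_mod_cast hp
  induction j generalizing k a with
  | zero =>
    rw [integral_Ico_div_split (fun a b => intervalIntegrable_sdigit hp x (k + 0) a b) hp,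
      ← pow_succ]
    have hmem : ∀ e < p, ∀ τ ∈ Set.Ioo (((a * p + e : ℕ) : ℝ) / (p : ℝ) ^ (k + 1))
        ((((a * p + e : ℕ) : ℝ) + 1) / (p : ℝ) ^ (k + 1)), (sdigit p x τ (k + 0) : ℝ) =
        ((((truncVal p x k + truncVal p ((a : ℝ) / (p : ℝ) ^ k) k) / p ^ k + rdigit p x k + e)
          % p : ℕ) : ℝ) := by
      intro e he τ hτ
      have hτ' := Set.Ioo_subset_Ico_self hτ
      rw [add_zero, sdigit_eq_mod hp]
      have h1 : rdigit p τ k = e := by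
        rw [rdigit_of_mem hp hτ' (by lia)]
        simp [Nat.mod_eq_of_lt he]
      have h2 : truncVal p τ k = truncVal p ((a : ℝ) / (p : ℝ) ^ k) k := by
        refine truncVal_congr fun r hr => ?_
        rw [rdigit_of_mem hp hτ' (by lia), rdigit_of_mem hp (left_mem_Ico_div hp k a) hr,
          show k + 1 - (r + 1) = (k - (r + 1)) + 1 by lia, pow_succ', ← Nat.div_div_eq_div_mul,
          mul_comm a p, Nat.mul_add_div hp, Nat.div_eq_of_lt he, add_zero]
      rw [h1, h2]
    rw [sum_congr rfl fun e he => (intervalIntegral.integral_congr_Ioo_of_le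
      (by gcongr; linarith) (hmem e (mem_range.1 he))).trans
      (intervalIntegral.integral_const _)]
    simp only [smul_eq_mul]
    rw [sum_congr rfl fun e _ => by rw [← sub_div, add_sub_cancel_left], ← mul_sum,
      sum_range_add_mod hp, pow_succ]
    field_simp
  | succ j ih =>
    rw [integral_Ico_div_split (fun a b => intervalIntegrable_sdigit hp x (k + (j + 1)) a b) hp,
      ← pow_succ]
    rw [show k + (j + 1) = k + 1 + j by lia]
    simp only [ih]
    rw [sum_const, card_range, nsmul_eq_mul, pow_succ]
    field_simp

theorem integral_rawShift {p : ℕ} (hp : 1 < p) (x : ℝ) (m a : ℕ) :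
    ∫ τ in ((a : ℝ) / (p : ℝ) ^ m)..(((a : ℝ) + 1) / (p : ℝ) ^ m), rawShift p x τ =
      midShift p m x ((a : ℝ) / (p : ℝ) ^ m) / (p : ℝ) ^ m := by
  have hp0 : 0 < p := by lia
  have hp' : (1 : ℝ) < p := by exact_mod_cast hp
  have hle : (a : ℝ) / (p : ℝ) ^ m ≤ ((a : ℝ) + 1) / (p : ℝ) ^ m := by gcongr; linarith
  have hgeom : HasSum (fun r : ℕ => ((p : ℝ) - 1) / (p : ℝ) ^ (r + 1)) 1 := by
    have := (hasSum_geometric_of_lt_one (r := (p : ℝ)⁻¹) (by positivity)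
      (inv_lt_one_of_one_lt₀ hp')).mul_left (((p : ℝ) - 1) / p)
    have h1 : (p : ℝ) - 1 ≠ 0 := by linarith
    have h2 : ((p : ℝ) - 1) / p * (1 - (p : ℝ)⁻¹)⁻¹ = 1 := by
      rw [← one_div (p : ℝ), one_sub_div (by positivity)]
      field_simp
    rw [h2] at this
    refine this.congr_fun fun r => ?_
    rw [pow_succ, inv_pow]
    field_simp
  have hsum := intervalIntegral.hasSum_integral_of_dominated_convergence (μ := volume)
    (a := (a : ℝ) / (p : ℝ) ^ m) (b := ((a : ℝ) + 1) / (p : ℝ) ^ m)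
    (F := fun r τ => (sdigit p x τ r : ℝ) / (p : ℝ) ^ (r + 1)) (f := fun τ => rawShift p x τ)
    (fun r _ => ((p : ℝ) - 1) / (p : ℝ) ^ (r + 1))
    (fun r => ((measurable_from_top (f := fun n : ℕ => (n : ℝ))).comp
      (measurable_sdigit p x r)).div_const _ |>.aestronglyMeasurable)
    (fun r => Filter.Eventually.of_forall fun τ _ => by
      have : ((sdigit p x τ r : ℝ) + 1) ≤ p := by exact_mod_cast sdigit_lt hp0 x τ r
      rw [Real.norm_of_nonneg (by positivity)]
      gcongr
      linarith)
    (Filter.Eventually.of_forall fun τ _ => hgeom.summable)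
    (by simp)
    (Filter.Eventually.of_forall fun τ _ => hasSum_rawShift hp0 x τ)
  have htail : HasSum (fun r : ℕ => ∫ τ in ((a : ℝ) / (p : ℝ) ^ m)..(((a : ℝ) + 1) / (p : ℝ) ^ m),
      (sdigit p x τ (r + m) : ℝ) / (p : ℝ) ^ (r + m + 1))
      (1 / (2 * (p : ℝ) ^ m) / (p : ℝ) ^ m) := by
    have := hgeom.mul_right (1 / (2 * (p : ℝ) ^ m) / (p : ℝ) ^ m)
    rw [one_mul] at this
    refine this.congr_fun fun r => ?_
    rw [intervalIntegral.integral_div, add_comm r m, integral_sdigit hp0]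
    rw [pow_succ, pow_succ, pow_add]
    field_simp
  have hhead : ∑ r ∈ range m, ∫ τ in ((a : ℝ) / (p : ℝ) ^ m)..(((a : ℝ) + 1) / (p : ℝ) ^ m),
      (sdigit p x τ r : ℝ) / (p : ℝ) ^ (r + 1) =
      simpShift p m x ((a : ℝ) / (p : ℝ) ^ m) / (p : ℝ) ^ m := by
    rw [← intervalIntegral.integral_finsetSum
      fun r _ => (intervalIntegrable_sdigit hp0 x r _ _).div_const _]
    rw [intervalIntegral.integral_congr_Ioo_of_le hle
      (g := fun _ => simpShift p m x ((a : ℝ) / (p : ℝ) ^ m))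
      (by exact fun τ hτ => simpShift_of_mem hp0 (Set.Ioo_subset_Ico_self hτ) x)]
    rw [intervalIntegral.integral_const, ← sub_div, add_sub_cancel_left, smul_eq_mul]
    ring
  rw [hsum.unique ((hasSum_nat_add_iff m).1 htail), hhead, midShift]
  ring

theorem rdigit_inj {p : ℕ} (hp : 1 < p) {x y : ℝ} (hx : x ∈ Set.Ico (0 : ℝ) 1)
    (hy : y ∈ Set.Ico (0 : ℝ) 1) (h : ∀ r, rdigit p x r = rdigit p y r) : x = y := by
  have : NeZero p := ⟨by lia⟩
  rw [← Real.ofDigits_digits hp hx, ← Real.ofDigits_digits hp hy]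
  congr 1
  ext r
  simpa [Real.digits, rdigit, Int.floor_toNat] using h r

theorem sdigit_of_rawShift_eq_one {p : ℕ} (hp : 1 < p) {x σ : ℝ} (h : rawShift p x σ = 1)
    (r : ℕ) : sdigit p x σ r = p - 1 := by
  have hp0 : 0 < p := by lia
  have hp' : (0 : ℝ) < p := by exact_mod_cast hp0
  have h1 := rawShift_le_simpShift_add hp0 (r + 1) x σ
  obtain ⟨K, hK, h2⟩ := exists_simpShift_eq_div hp0 r x σ
  rw [simpShift, sum_range_succ, ← simpShift, h2, h] at h1
  have hs := sdigit_lt hp0 x σ r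
  have hK' : (K : ℝ) + 1 ≤ (p : ℝ) ^ r := by exact_mod_cast hK
  have h3 : (p : ℝ) ^ r * p ≤ K * p + sdigit p x σ r + 1 := by
    rw [pow_succ] at h1
    field_simp at h1
    linarith
  have h4 : (p : ℝ) ≤ sdigit p x σ r + 1 := by nlinarith
  have h5 : p ≤ sdigit p x σ r + 1 := by exact_mod_cast h4
  lia

theorem pshift_ae_eq_rawShift {p : ℕ} (hp : 1 < p) (x : ℝ) :
    ∀ᵐ τ ∂(volume.restrict (Set.Ico (0 : ℝ) 1)), pshift p x τ = rawShift p x τ := by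
  have hp0 : 0 < p := by lia
  have hs : {τ | τ ∈ Set.Ico (0 : ℝ) 1 ∧ rawShift p x τ = 1}.Subsingleton := by
    intro τ hτ τ' hτ'
    refine rdigit_inj hp hτ.1 hτ'.1 fun r => ?_
    refine rdigit_eq_of_sdigit_eq hp0 x (r + 1) (fun s _ => ?_) r (Nat.lt_succ_self r)
    rw [sdigit_of_rawShift_eq_one hp hτ.2, sdigit_of_rawShift_eq_one hp hτ'.2]
  rw [ae_restrict_iff' measurableSet_Ico]
  filter_upwards [hs.countable.ae_notMem volume] with τ hτ hmem
  exact Int.fract_eq_self.2 ⟨rawShift_nonneg hp0 x τ,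
    lt_of_le_of_ne (rawShift_le_one hp0 x τ) fun h => hτ ⟨hmem, h⟩⟩

theorem radInv_eq {p : ℕ} (hp : 0 < p) (n : ℕ) :
    radInv p n = ((n % p : ℕ) + radInv p (n / p)) / p := by
  have hs : Summable fun r : ℕ => ((n / p ^ r % p : ℕ) : ℝ) / (p : ℝ) ^ (r + 1) :=
    Real.summable_ofDigitsTerm (digits := fun r => (⟨n / p ^ r % p, Nat.mod_lt _ hp⟩ : Fin p))
  rw [radInv, hs.tsum_eq_zero_add, radInv, add_div, ← tsum_div_const]
  congr 1
  · simp
  · congr 1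
    ext r
    rw [pow_succ' p r, Nat.div_div_eq_div_mul, pow_succ (p : ℝ) (r + 1), div_div]

theorem radInv_mem_Ico {p : ℕ} (hp : 1 < p) (n : ℕ) : radInv p n ∈ Set.Ico (0 : ℝ) 1 := by
  have hp' : (1 : ℝ) < p := by exact_mod_cast hp
  induction n using Nat.strong_induction_on with
  | _ n ih =>
    rcases Nat.eq_zero_or_pos n with rfl | hn
    · simp [radInv]
    · obtain ⟨h0, h1⟩ := ih (n / p) (Nat.div_lt_self hn hp)
      rw [radInv_eq (by lia)]
      have h2 : ((n % p : ℕ) : ℝ) + 1 ≤ p := by exact_mod_cast Nat.mod_lt n (by lia : 0 < p)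
      refine ⟨by positivity, ?_⟩
      rw [div_lt_one (by linarith)]
      linarith

theorem rdigit_radInv {p : ℕ} (hp : 1 < p) (n r : ℕ) :
    rdigit p (radInv p n) r = n / p ^ r % p := by
  have hp0 : (p : ℝ) ≠ 0 := by positivity
  induction r generalizing n with
  | zero =>
    obtain ⟨h0, h1⟩ := radInv_mem_Ico hp (n / p)
    rw [rdigit, radInv_eq (by lia), zero_add, pow_one, div_mul_cancel₀ _ hp0, Int.floor_toNat,
      add_comm ((n % p : ℕ) : ℝ), Nat.floor_add_natCast h0, Nat.floor_eq_zero.2 h1]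
    simp
  | succ r ih =>
    obtain ⟨h0, h1⟩ := radInv_mem_Ico hp (n / p)
    have h2 : radInv p n * (p : ℝ) ^ (r + 1 + 1) =
        ((n % p * p ^ (r + 1) : ℕ) : ℝ) + radInv p (n / p) * (p : ℝ) ^ (r + 1) := by
      rw [radInv_eq (by lia), pow_succ (p : ℝ) (r + 1)]
      push_cast
      field_simp
    rw [rdigit, h2, Int.floor_toNat, add_comm ((n % p * p ^ (r + 1) : ℕ) : ℝ),
      Nat.floor_add_natCast (by positivity), pow_succ p r, ← mul_assoc, Nat.add_mul_mod_self_right,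
      ← pow_succ, ← Int.floor_toNat, ← rdigit, ih,
      Nat.div_div_eq_div_mul, ← pow_succ']

theorem eq_of_simpShift_radInv_eq {p : ℕ} (hp : 1 < p) {m n h : ℕ} (hn : n < p ^ m)
    (hh : h < p ^ m) {σ : ℝ}
    (heq : simpShift p m (radInv p n) σ = simpShift p m (radInv p h) σ) : n = h := by
  have hp0 : 0 < p := by lia
  have h1 : ∀ r < m, rdigit p (radInv p n) r = rdigit p (radInv p h) r :=
    rdigit_eq_of_sdigit_eq hp0 σ m fun r hr => by
      rw [sdigit_comm, sdigit_eq_of_simpShift_eq hp0 m heq r hr, sdigit_comm]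
  have h2 : ∀ k ≤ m, n % p ^ k = h % p ^ k := by
    intro k
    induction k with
    | zero => simp [Nat.mod_one]
    | succ k ih =>
      intro hk
      have := h1 k hk
      rw [rdigit_radInv hp, rdigit_radInv hp] at this
      rw [Nat.mod_pow_succ, Nat.mod_pow_succ, ih (by lia), this]
  simpa [Nat.mod_eq_of_lt, hn, hh] using h2 m le_rfl

/-- The squared worst-case error as a function of the last coordinate of the points, the other
coordinates entering through the constants `C`, `A` and `B`. -/
noncomputable def lastCoordErr (N : ℕ) (C g : ℝ) (A : Fin N → ℝ) (B : Fin N → Fin N → ℝ)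
    (y : Fin N → ℝ) : ℝ :=
  C - 2 / (N : ℝ) * ∑ n, A n * (1 + g / 2 * (1 - y n ^ 2)) +
    1 / (N : ℝ) ^ 2 * ∑ n, ∑ h, B n h * (1 + g * min (1 - y n) (1 - y h))

theorem sqErr_succ (d N : ℕ) (γ : ℕ → ℝ) (P : Fin N → Fin (d + 1) → ℝ) :
    sqErr (d + 1) N γ P = lastCoordErr N (∏ j : Fin (d + 1), (1 + γ j.val / 3)) (γ d)
      (fun n => ∏ j : Fin d, (1 + γ j.val / 2 * (1 - P n j.castSucc ^ 2)))
      (fun n h => ∏ j : Fin d,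
        (1 + γ j.val * min (1 - P n j.castSucc) (1 - P h j.castSucc)))
      (fun n => P n (Fin.last d)) := by
  unfold sqErr lastCoordErr
  simp only [Fin.prod_univ_castSucc, Fin.val_castSucc, Fin.val_last]

theorem continuous_lastCoordErr (N : ℕ) (C g : ℝ) (A : Fin N → ℝ) (B : Fin N → Fin N → ℝ) :
    Continuous (lastCoordErr N C g A B) := by
  unfold lastCoordErr
  fun_prop

theorem intervalIntegrable_comp_of_mem_Icc {N : ℕ} {F : (Fin N → ℝ) → ℝ} (hF : Continuous F)
    {y : ℝ → Fin N → ℝ} (hy : Measurable y) (hmem : ∀ τ n, y τ n ∈ Set.Icc (0 : ℝ) 1)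
    (a b : ℝ) : IntervalIntegrable (fun τ => F (y τ)) volume a b := by
  obtain ⟨C, hC⟩ := (isCompact_univ_pi fun _ : Fin N => isCompact_Icc (a := (0 : ℝ))
    (b := 1)).exists_bound_of_continuousOn hF.continuousOn
  exact intervalIntegrable_of_bounded (hF.measurable.comp hy) C
    (fun τ => hC (y τ) fun n _ => hmem τ n) a b

/-- If the points `y τ` stay in disjoint cells around their midpoints `c`, the error at the
midpoints is bounded by the mean error. -/
theorem lastCoordErr_mul_le_integral {N : ℕ} (C : ℝ) {g : ℝ} (hg : 0 ≤ g) {A : Fin N → ℝ}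
    (hA : ∀ n, 0 ≤ A n) (B : Fin N → Fin N → ℝ) {y : ℝ → Fin N → ℝ} (hy : Measurable y)
    (hmem : ∀ τ n, y τ n ∈ Set.Icc (0 : ℝ) 1) {c : Fin N → ℝ} {a b ε : ℝ} (hε : 0 ≤ ε) (hab : a ≤ b)
    (hc : ∀ τ ∈ Set.Ioo a b, ∀ n, |y τ n - c n| ≤ ε)
    (hsep : ∀ n h, n ≠ h → c n + ε ≤ c h - ε ∨ c h + ε ≤ c n - ε)
    (hint : ∀ n, ∫ τ in a..b, y τ n = (b - a) * c n) :
    (b - a) * lastCoordErr N C g A B c ≤ ∫ τ in a..b, lastCoordErr N C g A B (y τ) := by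
  have hk : ∀ n h, ∃ k, min (1 - c n) (1 - c h) = 1 - c k ∧
      ∀ τ ∈ Set.Ioo a b, min (1 - y τ n) (1 - y τ h) = 1 - y τ k := by
    intro n h
    rcases eq_or_ne n h with rfl | hne
    · exact ⟨n, by simp, by simp⟩
    rcases hsep n h hne with hlt | hlt
    · refine ⟨h, min_eq_right (by linarith), fun τ hτ => min_eq_right ?_⟩
      have h1 := abs_le.1 (hc τ hτ n)
      have h2 := abs_le.1 (hc τ hτ h)
      linarith
    · refine ⟨n, min_eq_left (by linarith), fun τ hτ => min_eq_left ?_⟩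
      have h1 := abs_le.1 (hc τ hτ n)
      have h2 := abs_le.1 (hc τ hτ h)
      linarith
  choose k hkc hky using hk
  have hyi : ∀ n, IntervalIntegrable (fun τ => y τ n - c n) volume a b := fun n =>
    (intervalIntegrable_comp_of_mem_Icc (F := fun v => v n) (by fun_prop) hy hmem a b).sub
      intervalIntegrable_const
  have hdev : ∀ n, ∫ τ in a..b, (y τ n - c n) = 0 := fun n => by
    rw [intervalIntegral.integral_sub
      (intervalIntegrable_comp_of_mem_Icc (F := fun v => v n) (by fun_prop) hy hmem a b)
      intervalIntegrable_const, hint, intervalIntegral.integral_const, smul_eq_mul, sub_self]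
  have hS1 : IntervalIntegrable (fun τ => ∑ n, A n * (g * c n) * (y τ n - c n)) volume a b :=
    intervalIntegrable_comp_of_mem_Icc
      (F := fun v => ∑ n, A n * (g * c n) * (v n - c n)) (by fun_prop) hy hmem a b
  have hS2 : IntervalIntegrable (fun τ => ∑ n, ∑ h, B n h * g * (y τ (k n h) - c (k n h)))
      volume a b :=
    intervalIntegrable_comp_of_mem_Icc
      (F := fun v => ∑ n, ∑ h, B n h * g * (v (k n h) - c (k n h))) (by fun_prop) hy hmem a b
  have hI1 : ∫ τ in a..b, ∑ n, A n * (g * c n) * (y τ n - c n) = 0 := by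
    rw [intervalIntegral.integral_finsetSum fun n _ => (hyi n).const_mul _]
    simp [hdev]
  have hI2 : ∫ τ in a..b, ∑ n, ∑ h, B n h * g * (y τ (k n h) - c (k n h)) = 0 := by
    rw [intervalIntegral.integral_finsetSum fun n _ => intervalIntegrable_comp_of_mem_Icc
      (F := fun v => ∑ h, B n h * g * (v (k n h) - c (k n h))) (by fun_prop) hy hmem a b]
    refine sum_eq_zero fun n _ => ?_
    rw [intervalIntegral.integral_finsetSum fun h _ => (hyi _).const_mul _]
    simp [hdev]
  have hL : ∫ τ in a..b, (lastCoordErr N C g A B c +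
      2 / (N : ℝ) * ∑ n, A n * (g * c n) * (y τ n - c n) -
      1 / (N : ℝ) ^ 2 * ∑ n, ∑ h, B n h * g * (y τ (k n h) - c (k n h))) =
      (b - a) * lastCoordErr N C g A B c := by
    rw [intervalIntegral.integral_sub (intervalIntegrable_const.add (hS1.const_mul _))
      (hS2.const_mul _), intervalIntegral.integral_add intervalIntegrable_const
      (hS1.const_mul _), intervalIntegral.integral_const_mul,
      intervalIntegral.integral_const_mul, hI1, hI2, intervalIntegral.integral_const]
    simp
  rw [← hL]
  refine intervalIntegral.integral_mono_on_of_le_Ioo hab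
    ((intervalIntegrable_const.add (hS1.const_mul _)).sub (hS2.const_mul _))
    (intervalIntegrable_comp_of_mem_Icc (continuous_lastCoordErr N C g A B) hy hmem a b)
    fun τ hτ => ?_
  have h1 : ∑ n, A n * (1 + g / 2 * (1 - y τ n ^ 2)) ≤
      ∑ n, A n * (1 + g / 2 * (1 - c n ^ 2)) - ∑ n, A n * (g * c n) * (y τ n - c n) := by
    rw [← sum_sub_distrib]
    refine sum_le_sum fun n _ => ?_
    have : 0 ≤ A n * g * (y τ n - c n) ^ 2 := by have := hA n; positivity
    nlinarith
  have h2 : ∑ n, ∑ h, B n h * (1 + g * min (1 - y τ n) (1 - y τ h)) =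
      ∑ n, ∑ h, B n h * (1 + g * min (1 - c n) (1 - c h)) -
        ∑ n, ∑ h, B n h * g * (y τ (k n h) - c (k n h)) := by
    simp only [← sum_sub_distrib]
    refine sum_congr rfl fun n _ => sum_congr rfl fun h _ => ?_
    rw [hkc, hky n h τ hτ]
    ring
  have h3 := mul_le_mul_of_nonneg_left h1 (by positivity : 0 ≤ 2 / (N : ℝ))
  unfold lastCoordErr
  rw [h2]
  linarith

theorem simpShift_add_le_of_lt {p : ℕ} (hp : 0 < p) {m : ℕ} {x y σ τ : ℝ}
    (h : simpShift p m x σ < simpShift p m y τ) :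
    simpShift p m x σ + 1 / (p : ℝ) ^ m ≤ simpShift p m y τ := by
  have hp' : (0 : ℝ) < p := by exact_mod_cast hp
  obtain ⟨K, -, hK⟩ := exists_simpShift_eq_div hp m x σ
  obtain ⟨L, -, hL⟩ := exists_simpShift_eq_div hp m y τ
  rw [hK, hL] at h ⊢
  rw [← add_div]
  have : K < L := by exact_mod_cast (div_lt_div_iff_of_pos_right (by positivity)).1 h
  gcongr
  exact_mod_cast this

/-- On each elementary interval of length `p ^ (-m)` the mid-simplified shift of the first
`N < p ^ m` points does not exceed the mean over the exact shifts. -/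
theorem lastCoordErr_midShift_le_integral {N p m : ℕ} (hp : 1 < p) (hN : N < p ^ m) (C : ℝ)
    {g : ℝ} (hg : 0 ≤ g) {A : Fin N → ℝ} (hA : ∀ n, 0 ≤ A n) (B : Fin N → Fin N → ℝ) (a : ℕ) :
    1 / (p : ℝ) ^ m * lastCoordErr N C g A B
        (fun n => midShift p m (radInv p n.val) ((a : ℝ) / (p : ℝ) ^ m)) ≤
      ∫ τ in ((a : ℝ) / (p : ℝ) ^ m)..(((a : ℝ) + 1) / (p : ℝ) ^ m),
        lastCoordErr N C g A B fun n => rawShift p (radInv p n.val) τ := by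
  have hp0 : 0 < p := by lia
  have hp' : (0 : ℝ) < p := by exact_mod_cast hp0
  have hlen : ((a : ℝ) + 1) / (p : ℝ) ^ m - (a : ℝ) / (p : ℝ) ^ m = 1 / (p : ℝ) ^ m := by
    rw [← sub_div, add_sub_cancel_left]
  have hhalf : 1 / (2 * (p : ℝ) ^ m) + 1 / (2 * (p : ℝ) ^ m) = 1 / (p : ℝ) ^ m := by
    field_simp
    norm_num
  rw [← hlen]
  refine lastCoordErr_mul_le_integral C hg hA B (ε := 1 / (2 * (p : ℝ) ^ m))
    (y := fun τ n => rawShift p (radInv p n.val) τ)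
    (measurable_pi_lambda _ fun n => measurable_rawShift hp0 _)
    (fun τ n => ⟨rawShift_nonneg hp0 _ _, rawShift_le_one hp0 _ _⟩)
    (by positivity) (by gcongr; linarith) ?_ ?_ ?_
  · intro τ hτ n
    have h1 := simpShift_le_rawShift hp0 m (radInv p n.val) τ
    have h2 := rawShift_le_simpShift_add hp0 m (radInv p n.val) τ
    rw [simpShift_of_mem hp0 (Set.Ioo_subset_Ico_self hτ)] at h1 h2
    rw [abs_le, midShift]
    constructor <;> linarith
  · intro n h hne
    have hs : simpShift p m (radInv p n.val) ((a : ℝ) / (p : ℝ) ^ m) ≠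
        simpShift p m (radInv p h.val) ((a : ℝ) / (p : ℝ) ^ m) := fun heq =>
      hne (Fin.ext (eq_of_simpShift_radInv_eq hp (n.2.trans hN) (h.2.trans hN) heq))
    simp only [midShift]
    rcases lt_or_gt_of_ne hs with hlt | hlt
    · left
      have := simpShift_add_le_of_lt hp0 hlt
      linarith
    · right
      have := simpShift_add_le_of_lt hp0 hlt
      linarith
  · intro n
    rw [integral_rawShift hp, hlen]
    ring

/-- in the CBC construction, the error of the `(d+1)`-dimensional
mid-simplified shifted Halton point set with the minimizing last component `σ_{d+1}` is
bounded by the mean over all exact `p_{d+1}`-adic shifts of the last coordinate.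
Indices are 0-based: the paper's `p_j, m_j, γ_j, σ_j` are `p (j-1), m (j-1), γ (j-1), σ (j-1)`. -/
theorem cbc_step_error_le_average
    (N d : ℕ) (hN : 1 ≤ N)
    (p : ℕ → ℕ) (hp : ∀ j < d + 1, (p j).Prime)
    (hdist : ∀ i < d + 1, ∀ j < d + 1, p i = p j → i = j)
    (m : ℕ → ℕ)
    (hm : ∀ j < d + 1, 0 < m j ∧ N < p j ^ m j ∧ ∀ k, 0 < k → N < p j ^ k → m j ≤ k)
    (γ : ℕ → ℝ) (hγpos : ∀ j, 0 < γ j) (hγ1 : γ 0 ≤ 1) (hγmon : Antitone γ)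
    (σ : ℕ → ℝ) (hσQ : ∀ j < d + 1, QSet (p j) (m j) (σ j))
    (hmin : ∀ τ : ℝ, QSet (p d) (m d) τ →
      sqErr (d + 1) N γ
          (fun n j => midShift (p j.val) (m j.val) (radInv (p j.val) n.val) (σ j.val)) ≤
        sqErr (d + 1) N γ
          (fun n j => midShift (p j.val) (m j.val) (radInv (p j.val) n.val)
            (Function.update σ d τ j.val))) :
    sqErr (d + 1) N γ
        (fun n j => midShift (p j.val) (m j.val) (radInv (p j.val) n.val) (σ j.val)) ≤
      ∫ τ in Set.Ico (0 : ℝ) 1,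
        sqErr (d + 1) N γ fun n j =>
          if (j : ℕ) < d then midShift (p j.val) (m j.val) (radInv (p j.val) n.val) (σ j.val)
          else pshift (p d) (radInv (p d) n.val) τ := by
  have hp1 : 1 < p d := (hp d (by lia)).one_lt
  have hp0 : 0 < p d := by lia
  have hp' : (0 : ℝ) < p d := by exact_mod_cast hp0
  obtain ⟨-, hNm, -⟩ := hm d (by lia)
  set M : ℝ := (p d : ℝ) ^ m d with hM
  have hM0 : 0 < M := by positivity
  set C : ℝ := ∏ j : Fin (d + 1), (1 + γ j.val / 3)
  set Y : Fin N → Fin d → ℝ := fun n j =>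
    midShift (p j.val) (m j.val) (radInv (p j.val) n.val) (σ j.val)
  set A : Fin N → ℝ := fun n => ∏ j : Fin d, (1 + γ j.val / 2 * (1 - Y n j ^ 2))
  set B : Fin N → Fin N → ℝ := fun n h =>
    ∏ j : Fin d, (1 + γ j.val * min (1 - Y n j) (1 - Y h j))
  have hApos : ∀ n, 0 ≤ A n := fun n => prod_nonneg fun j _ => by
    obtain ⟨h0, h1⟩ := midShift_mem_Icc (hp j.val (by lia)).pos (m j.val)
      (radInv (p j.val) n.val) (σ j.val)
    have h2 : 0 ≤ 1 - Y n j ^ 2 := by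
      have : Y n j ^ 2 ≤ 1 := pow_le_one₀ h0 h1
      linarith
    have := (hγpos j.val).le
    positivity
  have hupd : ∀ τ, sqErr (d + 1) N γ (fun n j => midShift (p j.val) (m j.val)
      (radInv (p j.val) n.val) (Function.update σ d τ j.val)) =
      lastCoordErr N C (γ d) A B fun n => midShift (p d) (m d) (radInv (p d) n.val) τ := by
    intro τ
    rw [sqErr_succ]
    have : ∀ j : Fin d, Function.update σ d τ j.val = σ j.val := fun j =>
      Function.update_of_ne (by lia) _ _
    simp only [Fin.val_castSucc, Fin.val_last, Function.update_self, this]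
    rfl
  have hraw : ∫ τ in Set.Ico (0 : ℝ) 1, (sqErr (d + 1) N γ fun n j =>
      if (j : ℕ) < d then midShift (p j.val) (m j.val) (radInv (p j.val) n.val) (σ j.val)
      else pshift (p d) (radInv (p d) n.val) τ) =
      ∫ τ in (0 : ℝ)..1,
        lastCoordErr N C (γ d) A B fun n => rawShift (p d) (radInv (p d) n.val) τ := by
    rw [intervalIntegral.integral_of_le zero_le_one, ← integral_Ico_eq_integral_Ioc]
    refine integral_congr_ae ?_
    filter_upwards [ae_all_iff.2 fun n : Fin N => pshift_ae_eq_rawShift hp1 (radInv (p d) n.val)]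
      with τ hτ
    rw [sqErr_succ]
    simp only [Fin.val_castSucc, Fin.val_last, Fin.is_lt, if_true, lt_irrefl, if_false, hτ]
    rfl
  set E := sqErr (d + 1) N γ
    (fun n j => midShift (p j.val) (m j.val) (radInv (p j.val) n.val) (σ j.val))
  have hsplit := integral_Ico_div_split (fun a b => intervalIntegrable_comp_of_mem_Icc
    (continuous_lastCoordErr N C (γ d) A B)
    (y := fun τ n => rawShift (p d) (radInv (p d) n.val) τ)
    (measurable_pi_lambda _ fun n => measurable_rawShift hp0 _)
    (fun τ n => ⟨rawShift_nonneg hp0 _ _, rawShift_le_one hp0 _ _⟩) a b)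
    (q := p d ^ m d) (by positivity) 1 0
  simp only [Nat.cast_zero, zero_add, div_one, zero_mul, one_mul, Nat.cast_pow]
    at hsplit
  rw [hraw, hsplit]
  calc E = ∑ a ∈ range (p d ^ m d), 1 / M * E := by
        rw [sum_const, card_range, nsmul_eq_mul, Nat.cast_pow, ← hM, ← mul_assoc,
          mul_one_div_cancel hM0.ne', one_mul]
    _ ≤ _ := sum_le_sum fun a ha => by
        have h1 := hmin ((a : ℝ) / M) ⟨a, mem_range.1 ha, rfl⟩
        rw [hupd] at h1
        exact (mul_le_mul_of_nonneg_left h1 (by positivity)).trans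
          (lastCoordErr_midShift_le_integral hp1 hNm C (hγpos d).le hApos B a)
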